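/- There is a total computable function g : ℕ → ℕ → ℕ such that the relation E_g on ℕ defined by E_g x y ↔ (∀ n, g x n = g y n) is a Π⁰₁-complete equivalence relation: E_g is Π⁰₁, and every Π⁰₁ equivalence relation E on ℕ is computably reducible to E_g (there is a total computable f : ℕ → ℕ with E x y ↔ ∀ n, g (f x) n = g (f y) n for all x, y). -/

import Mathlib

/-- A binary relation on ℕ is Π⁰₁. -/
def Pi01Rel (E : ℕ → ℕ → Prop) : Prop :=
  ∃ R : ℕ → ℕ → ℕ → Bool,
    Computable (fun p : ℕ × ℕ × ℕ => R p.1 p.2.1 p.2.2) ∧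
    ∀ x y, E x y ↔ ∀ t, R x y t = true

open Nat.Partrec (Code)

/-- The complement of a Π⁰₁ relation is the union of an increasing sequence of uniformly primitive
recursive relations. -/
theorem Pi01Rel.exists_primrecRel_stage {E : ℕ → ℕ → Prop} (hE : Pi01Rel E) :
    ∃ S : ℕ → ℕ × ℕ → Prop, PrimrecRel S ∧ (∀ s t p, s ≤ t → S s p → S t p) ∧
      ∀ x y, ¬ E x y ↔ ∃ s, S s (x, y) := by
  obtain ⟨R, hR, hER⟩ := hE
  have hpart : Partrec fun n : ℕ => Nat.rfind
      (((fun t => ! R n.unpair.1 n.unpair.2 t) : ℕ → Bool) : ℕ →. Bool) := by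
    refine Partrec.rfind (Computable.partrec ?_)
    refine Primrec.not.to_comp.comp (hR.comp (g := fun p : ℕ × ℕ =>
      (p.1.unpair.1, p.1.unpair.2, p.2)) ?_)
    have hu : Computable fun p : ℕ × ℕ => p.1.unpair := Computable.unpair.comp Computable.fst
    exact (Computable.fst.comp hu).pair ((Computable.snd.comp hu).pair Computable.snd)
  obtain ⟨c, hc⟩ := Code.exists_code.1 (Partrec.nat_iff.1 hpart)
  refine ⟨fun s p => (c.evaln s (Nat.pair p.1 p.2)).isSome = true, ?_, ?_, ?_⟩
  · refine Primrec.primrecPred ?_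
    simp only [Bool.decide_eq_true]
    refine Primrec.option_isSome.comp (Code.primrec_evaln.comp (Primrec.pair
      (Primrec.pair Primrec.fst (Primrec.const c)) ?_))
    exact Primrec₂.natPair.comp (Primrec.fst.comp Primrec.snd) (Primrec.snd.comp Primrec.snd)
  · intro s t p hst h
    obtain ⟨a, ha⟩ := Option.isSome_iff_exists.1 h
    exact Option.isSome_iff_exists.2 ⟨a, Code.evaln_mono hst ha⟩
  · intro x y
    have hdom : (c.eval (Nat.pair x y)).Dom ↔ ¬ E x y := by
      rw [hc, hER]
      refine Nat.rfind_dom.trans ?_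
      simp
    rw [← hdom, Part.dom_iff_mem]
    simp only [Code.evaln_complete, Option.isSome_iff_exists]
    exact exists_comm

section Coloring

variable {E : ℕ → ℕ → Prop} {S : ℕ → ℕ × ℕ → Prop}

/-- By stage `s`, `x` has been separated from all elements of color `b` in the list `L`. -/
def SepFrom (S : ℕ → ℕ × ℕ → Prop) (L : List (ℕ × Bool)) (x s : ℕ) (b : Bool) : Prop :=
  ∀ p ∈ L, S s (x, p.1) ∨ p.2 ≠ b

theorem PrimrecRel.sepFrom (hS : PrimrecRel S) (b : Bool) :
    PrimrecRel fun (a : ℕ × List (ℕ × Bool)) s => SepFrom S a.2 a.1 s b := by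
  have h : PrimrecRel fun (p : ℕ × Bool) (q : ℕ × ℕ) => S q.2 (q.1, p.1) ∨ p.2 ≠ b := by
    refine PrimrecPred.or ?_ ?_
    · exact PrimrecRel.comp hS (Primrec.snd.comp Primrec.snd)
        ((Primrec.fst.comp Primrec.snd).pair (Primrec.fst.comp Primrec.fst))
    · exact PrimrecPred.not (PrimrecRel.comp Primrec.eq (Primrec.snd.comp Primrec.fst)
        (Primrec.const b))
  exact PrimrecRel.comp h.forall_mem_list (Primrec.snd.comp Primrec.fst)
    ((Primrec.fst.comp Primrec.fst).pair Primrec.snd)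

open Classical in
/-- Put `x` on top of the list of colored elements `L`, waiting until `x` is separated from one of
the two colors and giving it the other one. -/
noncomputable def extendColoring (S : ℕ → ℕ × ℕ → Prop) (a : ℕ × List (ℕ × Bool)) :
    Part (List (ℕ × Bool)) :=
  (Nat.rfind (((fun s => decide (SepFrom S a.2 a.1 s true ∨ SepFrom S a.2 a.1 s false)) :
    ℕ → Bool) : ℕ →. Bool)).map fun s => (a.1, ! decide (SepFrom S a.2 a.1 s true)) :: a.2

theorem partrec_extendColoring (hS : PrimrecRel S) : Partrec (extendColoring S) := by
  classical
  refine Partrec.map (Partrec.rfind (Computable.partrec ?_)) ?_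
  · exact (PrimrecPred.decide (PrimrecPred.or (hS.sepFrom true) (hS.sepFrom false))).to_comp
  · refine Computable.list_cons.comp (Computable.pair (Computable.fst.comp Computable.fst) ?_)
      (Computable.snd.comp Computable.fst)
    exact Primrec.not.to_comp.comp (PrimrecRel.decide (hS.sepFrom true)).to_comp

/-- `E`-related elements of `L` have the same color. -/
def IsColoring (E : ℕ → ℕ → Prop) (L : List (ℕ × Bool)) : Prop :=
  ∀ p ∈ L, ∀ q ∈ L, E p.1 q.1 → p.2 = q.2

theorem exists_sepFrom (hmono : ∀ s t p, s ≤ t → S s p → S t p)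
    (hES : ∀ x y, ¬ E x y ↔ ∃ s, S s (x, y)) (x : ℕ) (b : Bool) (L : List (ℕ × Bool))
    (h : ∀ p ∈ L, p.2 = b → ¬ E x p.1) : ∃ s, SepFrom S L x s b := by
  induction L with
  | nil => exact ⟨0, by simp [SepFrom]⟩
  | cons p L ih =>
    obtain ⟨s, hs⟩ := ih fun q hq => h q (List.mem_cons_of_mem _ hq)
    obtain ⟨t, ht⟩ : ∃ t, S t (x, p.1) ∨ p.2 ≠ b := by
      by_cases hp : p.2 = b
      · exact ((hES _ _).1 (h p List.mem_cons_self hp)).imp fun _ => Or.inl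
      · exact ⟨0, Or.inr hp⟩
    refine ⟨max s t, fun q hq => ?_⟩
    rcases List.mem_cons.1 hq with rfl | hq
    · exact ht.imp_left (hmono _ _ _ (le_max_right _ _))
    · exact (hs q hq).imp_left (hmono _ _ _ (le_max_left _ _))

theorem SepFrom.isColoring_cons (hE : Equivalence E) (hES : ∀ x y, ¬ E x y ↔ ∃ s, S s (x, y))
    {L : List (ℕ × Bool)} (hL : IsColoring E L) {x s : ℕ} {b : Bool} (h : SepFrom S L x s (! b)) :
    IsColoring E ((x, b) :: L) := by
  have hx : ∀ q ∈ L, E x q.1 → q.2 = b := fun q hq hxq => by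
    rcases h q hq with h | h
    · exact absurd hxq ((hES _ _).2 ⟨s, h⟩)
    · simpa using h
  intro p hp q hq hpq
  rcases List.mem_cons.1 hp with rfl | hp <;> rcases List.mem_cons.1 hq with rfl | hq
  · rfl
  · exact (hx q hq hpq).symm
  · exact hx p hp (hE.symm hpq)
  · exact hL p hp q hq hpq

theorem exists_mem_extendColoring (hE : Equivalence E)
    (hmono : ∀ s t p, s ≤ t → S s p → S t p) (hES : ∀ x y, ¬ E x y ↔ ∃ s, S s (x, y))
    (x : ℕ) {L : List (ℕ × Bool)} (hL : IsColoring E L) :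
    ∃ b, (x, b) :: L ∈ extendColoring S (x, L) ∧ IsColoring E ((x, b) :: L) := by
  classical
  have hex : ∃ s, SepFrom S L x s true ∨ SepFrom S L x s false := by
    by_cases h : ∃ p ∈ L, p.2 = true ∧ E x p.1
    · obtain ⟨p, hp, hpt, hxp⟩ := h
      refine (exists_sepFrom hmono hES x false L fun q hq hqf hxq => ?_).imp fun _ => Or.inr
      have := hL p hp q hq (hE.trans (hE.symm hxp) hxq)
      simp_all
    · push Not at h
      exact (exists_sepFrom hmono hES x true L h).imp fun _ => Or.inl
  obtain ⟨s₀, hs₀⟩ := hex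
  obtain ⟨s, hs, -⟩ := Nat.rfind_min' (p := fun s =>
    decide (SepFrom S L x s true ∨ SepFrom S L x s false)) (decide_eq_true hs₀)
  refine ⟨! decide (SepFrom S L x s true), Part.mem_map _ hs, ?_⟩
  have hspec : SepFrom S L x s true ∨ SepFrom S L x s false := by
    simpa using Nat.rfind_spec hs
  by_cases h : SepFrom S L x s true
  · exact SepFrom.isColoring_cons hE hES (s := s) hL (by simp [h])
  · exact SepFrom.isColoring_cons hE hES (s := s) hL (by simpa [h] using hspec)

open Classical in
/-- Start with two different colors at the two given elements, if they are already separated. -/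
noncomputable def initColoring (S : ℕ → ℕ × ℕ → Prop) (a : ℕ × ℕ × ℕ) : List (ℕ × Bool) :=
  bif decide (S a.1 a.2) then [(a.2.1, false), (a.2.2, true)] else []

theorem computable_initColoring (hS : PrimrecRel S) : Computable (initColoring S) := by
  classical
  refine Computable.cond (PrimrecRel.decide hS).to_comp ?_ (Computable.const [])
  have h₁ : Computable fun a : ℕ × ℕ × ℕ => (a.2.1, false) :=
    (Computable.fst.comp Computable.snd).pair (Computable.const false)
  have h₂ : Computable fun a : ℕ × ℕ × ℕ => (a.2.2, true) :=
    (Computable.snd.comp Computable.snd).pair (Computable.const true)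
  exact Computable.list_cons.comp h₁ (Computable.list_cons.comp h₂ (Computable.const []))

theorem isColoring_initColoring (hE : Equivalence E) (hES : ∀ x y, ¬ E x y ↔ ∃ s, S s (x, y))
    (a : ℕ × ℕ × ℕ) : IsColoring E (initColoring S a) := by
  classical
  by_cases h : S a.1 a.2
  · have h₁ : ¬ E a.2.1 a.2.2 := (hES _ _).2 ⟨a.1, h⟩
    have h₂ : ¬ E a.2.2 a.2.1 := fun h => h₁ (hE.symm h)
    intro p hp q hq
    simp only [initColoring, h, decide_true, cond_true, List.mem_cons, List.not_mem_nil,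
      or_false] at hp hq
    rcases hp with rfl | rfl <;> rcases hq with rfl | rfl <;> simp [h₁, h₂]
  · simp [initColoring, h, IsColoring]

end Coloring

/-- Every Π⁰₁ equivalence relation is the equality of columns of a computable function. -/
theorem Pi01Rel.exists_computable_column_eq {E : ℕ → ℕ → Prop} (hE : Pi01Rel E)
    (heq : Equivalence E) :
    ∃ h : ℕ → ℕ → ℕ, Computable₂ h ∧ ∀ x y, E x y ↔ ∀ n, h x n = h y n := by
  classical
  obtain ⟨S, hS, hmono, hES⟩ := hE.exists_primrecRel_stage
  let st (a : (ℕ × ℕ × ℕ) × ℕ) : Part (List (ℕ × Bool)) :=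
    Nat.rec (Part.some (initColoring S a.1))
      (fun x IH => IH.bind fun L => extendColoring S (x, L)) a.2
  have hst : Partrec st := Partrec.nat_rec Computable.snd
    ((computable_initColoring hS).comp Computable.fst).partrec
    ((partrec_extendColoring hS).comp Computable.snd).to₂
  have hdom : ∀ a k, ∃ L, L ∈ st (a, k) ∧ IsColoring E L := by
    intro a k
    induction k with
    | zero => exact ⟨_, Part.mem_some _, isColoring_initColoring heq hES a⟩
    | succ k ih =>
      obtain ⟨L, hL, hc⟩ := ih
      obtain ⟨b, hb, hbc⟩ := exists_mem_extendColoring heq hmono hES k hc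
      exact ⟨_, Part.mem_bind hL hb, hbc⟩
  choose L hL hLc using hdom
  have hLcomp : Computable fun a : (ℕ × ℕ × ℕ) × ℕ => L a.1 a.2 :=
    hst.of_eq_tot fun a => hL a.1 a.2
  have hzero : ∀ a, L a 0 = initColoring S a := fun a => Part.mem_unique (hL a 0) (Part.mem_some _)
  have hsucc : ∀ a k, ∃ b, L a (k + 1) = (k, b) :: L a k := by
    intro a k
    obtain ⟨b, hb, -⟩ := exists_mem_extendColoring heq hmono hES k (hLc a k)
    exact ⟨b, Part.mem_unique (hL a (k + 1)) (Part.mem_bind (hL a k) hb)⟩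
  choose col hcol using hsucc
  have hle : ∀ a {j k}, j ≤ k → L a j ⊆ L a k := by
    intro a j k hjk
    induction hjk with
    | refl => exact List.Subset.refl _
    | step _ ih => exact List.Subset.trans ih (by simp [hcol])
  have hmem : ∀ a {j k}, j < k → (j, col a j) ∈ L a k := fun a j k hjk =>
    hle a (Nat.succ_le_of_lt hjk) (by simp [hcol])
  obtain ⟨par, hpar, hsurj⟩ : ∃ par : ℕ → ℕ × ℕ × ℕ, Computable par ∧ Function.Surjective par :=
    ⟨Denumerable.ofNat _, Computable.ofNat _, fun a => ⟨Encodable.encode a, Denumerable.ofNat_encode a⟩⟩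
  refine ⟨fun x n => Encodable.encode ((L (par n) (x + 1)).head?.map Prod.snd), ?_, ?_⟩
  · refine Computable.encode.comp (Computable.option_map
      (Primrec.list_head?.to_comp.comp (hLcomp.comp (g := fun p : ℕ × ℕ => (par p.2, p.1 + 1)) ?_))
      (Computable.snd.comp Computable.snd))
    exact (hpar.comp Computable.snd).pair (Computable.succ.comp Computable.fst)
  · intro x y
    have hval : ∀ n x, (L (par n) (x + 1)).head?.map Prod.snd = some (col (par n) x) := by
      simp [hcol]
    simp only [hval, Encodable.encode_inj, Option.some.injEq]
    constructor
    · intro hxy n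
      exact hLc (par n) (x + y + 1) _ (hmem _ (by omega)) _ (hmem _ (by omega)) hxy
    · intro h
      by_contra hxy
      obtain ⟨s, hs⟩ := (hES x y).1 hxy
      obtain ⟨n, hn⟩ : ∃ n, par n = (s, x, y) := hsurj _
      have h₀ : ∀ p, p ∈ [(x, false), (y, true)] → p ∈ L (par n) (x + y + 1) := fun p hp =>
        hle _ (Nat.zero_le _) (by rw [hzero, hn]; simpa [initColoring, hs] using hp)
      have h₁ := hLc (par n) (x + y + 1) _ (hmem _ (by omega : x < x + y + 1)) _
        (h₀ (x, false) (by simp)) (heq.refl x)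
      have h₂ := hLc (par n) (x + y + 1) _ (hmem _ (by omega : y < x + y + 1)) _
        (h₀ (y, true) (by simp)) (heq.refl y)
      have := h n
      simp_all

theorem Computable₂.list_map_range {h : ℕ → ℕ → ℕ} (hh : Computable₂ h) :
    Computable₂ fun a k => (List.range k).map (h a) := by
  have hentry : Computable fun q : (ℕ × ℕ) × ℕ × List ℕ => h q.1.1 q.2.1 :=
    Computable₂.comp hh (Computable.fst.comp Computable.fst) (Computable.fst.comp Computable.snd)
  have hstep : Computable₂ fun (p : ℕ × ℕ) (q : ℕ × List ℕ) => q.2 ++ [h p.1 q.1] :=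
    Computable.list_concat.comp (Computable.snd.comp Computable.snd) hentry
  refine (Computable.nat_rec Computable.snd (Computable.const []) hstep).of_eq fun p => ?_
  induction p.2 with
  | zero => rfl
  | succ k ih => simp [ih, List.range_succ]

/-- A computable function whose columns simulate those of every computable function `h`. An index
of column `x` of `h` consists of a code for `n ↦ [h 0 n, …, h n n]` and the list
`[h x 0, …, h x (x - 1)]`. The entry `h x n` is shown at those stages `s` at which the computation
of the code at `n` has converged, which does not depend on `x`. -/
def universalColumns (i m : ℕ) : ℕ :=
  let a : Code × List ℕ := Denumerable.ofNat _ i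
  Encodable.encode ((a.1.evaln m.unpair.2 m.unpair.1).map fun T =>
    a.2[m.unpair.1]? <|> (Denumerable.ofNat (List ℕ) T)[a.2.length]?)

theorem primrec_universalColumns : Primrec₂ universalColumns := by
  have ha : Primrec fun p : ℕ × ℕ => (Denumerable.ofNat (Code × List ℕ) p.1) :=
    (Primrec.ofNat _).comp Primrec.fst
  have hn : Primrec fun p : ℕ × ℕ => p.2.unpair.1 :=
    Primrec.fst.comp (Primrec.unpair.comp Primrec.snd)
  have hs : Primrec fun p : ℕ × ℕ => p.2.unpair.2 :=
    Primrec.snd.comp (Primrec.unpair.comp Primrec.snd)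
  refine Primrec.encode.comp (Primrec.option_map
    (Code.primrec_evaln.comp ((hs.pair (Primrec.fst.comp ha)).pair hn)) ?_)
  refine Primrec.option_orElse.comp ?_ ?_
  · exact (Primrec.list_getElem?.comp (Primrec.snd.comp ha) hn).comp Primrec.fst
  · exact Primrec.list_getElem?.comp ((Primrec.ofNat _).comp Primrec.snd)
      ((Primrec.list_length.comp (Primrec.snd.comp ha)).comp Primrec.fst)

theorem Computable₂.exists_universalColumns {h : ℕ → ℕ → ℕ} (hh : Computable₂ h) :
    ∃ f : ℕ → ℕ, Computable f ∧ ∀ x y, (∀ n, h x n = h y n) ↔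
      ∀ m, universalColumns (f x) m = universalColumns (f y) m := by
  have hT : Computable fun n : ℕ => Encodable.encode ((List.range (n + 1)).map fun x => h x n) :=
    Computable.encode.comp ((Computable₂.list_map_range (h := fun n x => h x n)
      (hh.comp Computable.snd Computable.fst)).comp Computable.id Computable.succ)
  obtain ⟨c, hc⟩ := Code.exists_code.1 (Partrec.nat_iff.1 hT.partrec)
  let f (x : ℕ) : ℕ := Encodable.encode (c, (List.range x).map (h x))
  have hf : ∀ x n s, universalColumns (f x) (Nat.pair n s) =
      Encodable.encode ((c.evaln s n).map fun _ => some (h x n)) := by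
    intro x n s
    simp only [universalColumns, f, Denumerable.ofNat_encode, Nat.unpair_pair]
    congr 1
    refine Option.map_congr fun T hTs => ?_
    have hT' : T = Encodable.encode ((List.range (n + 1)).map fun x => h x n) := by
      simpa [hc] using Code.evaln_sound hTs
    subst hT'
    rcases lt_or_ge n x with hnx | hnx
    · simp [hnx]
    · simp [hnx, Nat.lt_succ_of_le hnx]
  refine ⟨f, Computable.encode.comp ((Computable.const c).pair
    (hh.list_map_range.comp Computable.id Computable.id)), fun x y => ⟨fun hxy m => ?_, ?_⟩⟩
  · rw [← Nat.pair_unpair m, hf, hf, hxy]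
  · intro hxy n
    have hmem : Encodable.encode ((List.range (n + 1)).map fun x => h x n) ∈ c.eval n := by
      simp [hc]
    obtain ⟨s, hs⟩ := Code.evaln_complete.1 hmem
    have := hxy (Nat.pair n s)
    rw [hf, hf, Option.mem_def.1 hs] at this
    simpa using this

/-- There is a computable binary function `g` whose column-equality relation
is a Π⁰₁-complete equivalence relation. -/
theorem stmt_5 :
    ∃ g : ℕ → ℕ → ℕ, Computable₂ g ∧
      Equivalence (fun x y => ∀ n, g x n = g y n) ∧
      Pi01Rel (fun x y => ∀ n, g x n = g y n) ∧
      ∀ E : ℕ → ℕ → Prop, Pi01Rel E → Equivalence E →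
        ∃ f : ℕ → ℕ, Computable f ∧
          ∀ x y, E x y ↔ ∀ n, g (f x) n = g (f y) n := by
  refine ⟨universalColumns, primrec_universalColumns.to_comp, ⟨fun _ _ => rfl,
    fun h n => (h n).symm, fun h h' n => (h n).trans (h' n)⟩, ?_, fun E hE heq => ?_⟩
  · refine ⟨fun x y t => decide (universalColumns x t = universalColumns y t), ?_, by simp⟩
    have ht : Primrec fun p : ℕ × ℕ × ℕ => p.2.2 := Primrec.snd.comp Primrec.snd
    exact (PrimrecRel.comp Primrec.eq (primrec_universalColumns.comp Primrec.fst ht)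
      (primrec_universalColumns.comp (Primrec.fst.comp Primrec.snd) ht)).decide.to_comp
  · obtain ⟨h, hh, hEh⟩ := hE.exists_computable_column_eq heq
    obtain ⟨f, hf, hfh⟩ := hh.exists_universalColumns
    exact ⟨f, hf, fun x y => (hEh x y).trans (hfh x y)⟩
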